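/- Let f ∈ Lip_{[2]}(ℝ) with ‖f‖_{Lip_{[2]}} ≤ 1 and t ≥ 0. Then P_t f ∈ Lip_{[2]}(ℝ): P_t f is 1-Lipschitz and its derivative (P_t f)′ is 2-Lipschitz. Moreover, for every t > 0 and every x ∈ ℝ, |𝓛₀(P_t f)(x)| ≤ (2/(1 − e^{−t})) · sup_{z∈ℝ} |f′(z)|. -/

import Mathlib

open MeasureTheory ProbabilityTheory Real

/-- The standard Gumbel distribution `𝒢(0,1)`. -/
noncomputable def gumbel : Measure ℝ :=
  (volume : Measure ℝ).withDensity (fun x => ENNReal.ofReal (Real.exp (-(x + Real.exp (-x)))))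

/-- The operator `P_t`: `P_t f x = E[f (max (x - t) (Z + log (1 - e^{-t})))]`
where `Z` is standard Gumbel. -/
noncomputable def Pt (t : ℝ) (f : ℝ → ℝ) (x : ℝ) : ℝ :=
  ∫ z, f (max (x - t) (z + Real.log (1 - Real.exp (-t)))) ∂gumbel

/-- The Stein operator for the Gumbel distribution:
`𝓛₀ g x = -g' x + e^{-x} ∫_0^∞ e^{-y} g' (x+y) dy`. -/
noncomputable def L0 (g : ℝ → ℝ) (x : ℝ) : ℝ :=
  -(deriv g x) + Real.exp (-x) * ∫ y in Set.Ioi (0 : ℝ), Real.exp (-y) * deriv g (x + y)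

lemma mul_exp_neg_le_one (w : ℝ) : w * Real.exp (-w) ≤ 1 := by
  rw [Real.exp_neg, ← div_eq_mul_inv, div_le_one (Real.exp_pos w)]
  linarith [Real.add_one_le_exp w]

lemma gumbel_density_le (z : ℝ) : Real.exp (-(z + Real.exp (-z))) ≤ Real.exp (-|z|) := by
  rw [Real.exp_le_exp, neg_le_neg_iff]
  rcases le_total 0 z with hz | hz
  · rw [abs_of_nonneg hz]
    linarith [Real.exp_pos (-z)]
  · rw [abs_of_nonpos hz]
    have h : -z * 2 ≤ Real.exp (-z) := by
      have h1 := Real.add_one_le_exp (-z - 1)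
      have h2 : Real.exp (-z) = Real.exp (-z - 1) * Real.exp 1 := by
        rw [← Real.exp_add]; ring_nf
      have h3 := Real.exp_one_gt_d9
      rw [h2]
      exact mul_le_mul (by linarith) (by linarith) (by norm_num) (Real.exp_pos _).le
    linarith

lemma one_add_abs_mul_exp_neg_abs_le (z : ℝ) :
    (1 + |z|) * Real.exp (-|z|) ≤ 10 * (1 + z ^ 2)⁻¹ := by
  have h0 := abs_nonneg z
  have h1 := Real.add_one_le_exp |z|
  have h2 := Real.pow_div_factorial_le_exp |z| h0 2
  have h3 := Real.pow_div_factorial_le_exp |z| h0 3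
  norm_num [Nat.factorial] at h2 h3
  rw [Real.exp_neg, ← div_eq_mul_inv, ← div_eq_mul_inv,
    div_le_div_iff₀ (Real.exp_pos _) (by positivity), ← sq_abs z]
  rw [← sq_abs z] at h2
  nlinarith

lemma continuous_gumbel_density : Continuous fun z : ℝ => Real.exp (-(z + Real.exp (-z))) := by
  fun_prop

lemma integrable_one_add_abs_mul_gumbel_density :
    Integrable fun z : ℝ => (1 + |z|) * Real.exp (-(z + Real.exp (-z))) := by
  refine (integrable_inv_one_add_sq.const_mul 10).mono'
    (by fun_prop : Continuous _).aestronglyMeasurable (.of_forall fun z => ?_)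
  rw [Real.norm_of_nonneg (by positivity)]
  exact (mul_le_mul_of_nonneg_left (gumbel_density_le z) (by positivity)).trans
    (one_add_abs_mul_exp_neg_abs_le z)

lemma integrable_gumbel_density :
    Integrable fun z : ℝ => Real.exp (-(z + Real.exp (-z))) := by
  refine integrable_one_add_abs_mul_gumbel_density.mono'
    continuous_gumbel_density.aestronglyMeasurable (.of_forall fun z => ?_)
  rw [Real.norm_of_nonneg (Real.exp_pos _).le]
  exact le_mul_of_one_le_left (Real.exp_pos _).le (by linarith [abs_nonneg z])

/-- The cumulative distribution function of the standard Gumbel distribution. -/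
noncomputable def gumbelCDF (x : ℝ) : ℝ := Real.exp (-Real.exp (-x))

lemma gumbelCDF_nonneg (x : ℝ) : 0 ≤ gumbelCDF x := (Real.exp_pos _).le

lemma gumbelCDF_le_one (x : ℝ) : gumbelCDF x ≤ 1 :=
  Real.exp_le_one_iff.2 (neg_nonpos.2 (Real.exp_pos _).le)

lemma hasDerivAt_gumbelCDF (x : ℝ) :
    HasDerivAt gumbelCDF (Real.exp (-(x + Real.exp (-x)))) x := by
  have h := ((hasDerivAt_neg x).exp.neg).exp
  refine h.congr_deriv ?_
  rw [neg_add, Real.exp_add]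
  simp [mul_comm]

lemma lipschitzWith_gumbelCDF : LipschitzWith 1 gumbelCDF := by
  refine lipschitzWith_of_nnnorm_deriv_le
    (fun x => (hasDerivAt_gumbelCDF x).differentiableAt) fun x => ?_
  rw [(hasDerivAt_gumbelCDF x).deriv, ← NNReal.coe_le_coe, coe_nnnorm,
    Real.norm_of_nonneg (Real.exp_pos _).le, neg_add, Real.exp_add]
  exact mul_exp_neg_le_one _

lemma tendsto_gumbelCDF_atTop : Filter.Tendsto gumbelCDF Filter.atTop (nhds 1) := by
  have h := (Real.continuous_exp.tendsto _).comp
    (Real.tendsto_exp_neg_atTop_nhds_zero.neg)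
  rwa [neg_zero, Real.exp_zero] at h

lemma tendsto_gumbelCDF_atBot : Filter.Tendsto gumbelCDF Filter.atBot (nhds 0) :=
  Real.tendsto_exp_neg_atTop_nhds_zero.comp
    (Real.tendsto_exp_atTop.comp Filter.tendsto_neg_atBot_atTop)

instance : NullSingletonClass gumbel := by
  unfold gumbel; infer_instance

instance : IsProbabilityMeasure gumbel := by
  constructor
  rw [gumbel, withDensity_apply _ MeasurableSet.univ, Measure.restrict_univ,
    ← ofReal_integral_eq_lintegral_ofReal integrable_gumbel_density
      (.of_forall fun z => (Real.exp_pos _).le),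
    integral_of_hasDerivAt_of_tendsto hasDerivAt_gumbelCDF integrable_gumbel_density
      tendsto_gumbelCDF_atBot tendsto_gumbelCDF_atTop]
  simp

lemma gumbel_real_Iic (a : ℝ) : gumbel.real (Set.Iic a) = gumbelCDF a := by
  rw [measureReal_def, gumbel, withDensity_apply _ measurableSet_Iic,
    ← ofReal_integral_eq_lintegral_ofReal integrable_gumbel_density.integrableOn
      (.of_forall fun z => (Real.exp_pos _).le),
    integral_Iic_of_hasDerivAt_of_tendsto' (fun x _ => hasDerivAt_gumbelCDF x)
      integrable_gumbel_density.integrableOn tendsto_gumbelCDF_atBot, sub_zero,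
    ENNReal.toReal_ofReal (gumbelCDF_nonneg a)]

lemma integrable_one_add_abs_gumbel : Integrable (fun z : ℝ => 1 + |z|) gumbel := by
  rw [gumbel, integrable_withDensity_iff (by fun_prop) (.of_forall fun _ => ENNReal.ofReal_lt_top)]
  simpa only [ENNReal.toReal_ofReal (Real.exp_pos _).le] using
    integrable_one_add_abs_mul_gumbel_density

lemma lipschitzWith_comp_max {f : ℝ → ℝ} (hf : LipschitzWith 1 f) (b : ℝ) :
    LipschitzWith 1 fun u => f (max u b) := by
  simpa [Function.comp_def] using hf.comp (LipschitzWith.id.max_const b)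

lemma integrable_comp_max_gumbel {f : ℝ → ℝ} (hf : LipschitzWith 1 f) (u s : ℝ) :
    Integrable (fun z => f (max u (z + s))) gumbel := by
  refine (integrable_one_add_abs_gumbel.const_mul (|f 0| + |u| + |s| + 1)).mono'
    (hf.continuous.comp (by fun_prop)).aestronglyMeasurable (.of_forall fun z => ?_)
  have h1 := hf.dist_le_mul (max u (z + s)) 0
  simp only [NNReal.coe_one, one_mul, Real.dist_eq, sub_zero] at h1
  have h2 : |max u (z + s)| ≤ |u| + (|z| + |s|) :=
    abs_max_le_max_abs_abs.trans (max_le (by linarith [abs_nonneg z, abs_nonneg s])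
      ((abs_add_le z s).trans (by linarith [abs_nonneg u])))
  have h3 := abs_sub_abs_le_abs_sub (f (max u (z + s))) (f 0)
  rw [Real.norm_eq_abs]
  nlinarith [abs_nonneg z, abs_nonneg s, abs_nonneg u, abs_nonneg (f 0),
    mul_nonneg (abs_nonneg z) (abs_nonneg s), mul_nonneg (abs_nonneg z) (abs_nonneg u),
    mul_nonneg (abs_nonneg z) (abs_nonneg (f 0))]

lemma hasDerivAt_integral_comp_max_gumbel {f : ℝ → ℝ} (hfd : Differentiable ℝ f)
    (hf : LipschitzWith 1 f) (u s : ℝ) :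
    HasDerivAt (fun v => ∫ z, f (max v (z + s)) ∂gumbel) (deriv f u * gumbelCDF (u - s)) u := by
  have hderiv : ∀ᵐ z ∂gumbel, HasDerivAt (fun v => f (max v (z + s)))
      ((Set.Iic (u - s)).indicator (fun _ => deriv f u) z) u := by
    filter_upwards [Measure.ae_ne gumbel (u - s)] with z hz
    rcases lt_or_gt_of_ne hz with h | h
    · rw [Set.indicator_of_mem (Set.mem_Iic.2 h.le)]
      refine (hfd u).hasDerivAt.congr_of_eventuallyEq ?_
      filter_upwards [lt_mem_nhds (show z + s < u by linarith)] with v hv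
      rw [max_eq_left hv.le]
    · rw [Set.indicator_of_notMem (by simpa using h)]
      refine (hasDerivAt_const u (f (z + s))).congr_of_eventuallyEq ?_
      filter_upwards [gt_mem_nhds (show u < z + s by linarith)] with v hv
      rw [max_eq_right hv.le]
  have h := (hasDerivAt_integral_of_dominated_loc_of_lip (μ := gumbel) (bound := fun _ => 1)
    (F := fun v z => f (max v (z + s))) Filter.univ_mem
    (.of_forall fun v => (integrable_comp_max_gumbel hf v s).aestronglyMeasurable)
    (integrable_comp_max_gumbel hf u s)
    (aestronglyMeasurable_const.indicator measurableSet_Iic)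
    (.of_forall fun z => by simpa using lipschitzWith_comp_max hf (z + s))
    (integrable_const 1) hderiv).2
  rwa [integral_indicator_const _ measurableSet_Iic, gumbel_real_Iic, smul_eq_mul, mul_comm] at h

lemma hasDerivAt_Pt {f : ℝ → ℝ} (hfd : Differentiable ℝ f) (hf : LipschitzWith 1 f) (t x : ℝ) :
    HasDerivAt (Pt t f)
      (deriv f (x - t) * gumbelCDF (x - t - Real.log (1 - Real.exp (-t)))) x :=
  (hasDerivAt_integral_comp_max_gumbel hfd hf (x - t) _).comp_sub_const x t

lemma abs_deriv_le_one {f : ℝ → ℝ} (hf : LipschitzWith 1 f) (x : ℝ) : |deriv f x| ≤ 1 := by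
  simpa using norm_deriv_le_of_lipschitz (x₀ := x) hf

lemma lipschitzWith_Pt {f : ℝ → ℝ} (hfd : Differentiable ℝ f) (hf : LipschitzWith 1 f) (t : ℝ) :
    LipschitzWith 1 (Pt t f) := by
  refine lipschitzWith_of_nnnorm_deriv_le
    (fun x => (hasDerivAt_Pt hfd hf t x).differentiableAt) fun x => ?_
  rw [(hasDerivAt_Pt hfd hf t x).deriv, ← NNReal.coe_le_coe, coe_nnnorm, Real.norm_eq_abs,
    abs_mul, abs_of_nonneg (gumbelCDF_nonneg _)]
  exact mul_le_one₀ (abs_deriv_le_one hf _) (gumbelCDF_nonneg _) (gumbelCDF_le_one _)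

lemma lipschitzWith_deriv_Pt {f : ℝ → ℝ} (hfd : Differentiable ℝ f) (hf : LipschitzWith 1 f)
    (hf' : LipschitzWith 1 (deriv f)) (t : ℝ) : LipschitzWith 2 (deriv (Pt t f)) := by
  refine LipschitzWith.of_dist_le_mul fun x y => ?_
  rw [(hasDerivAt_Pt hfd hf t x).deriv, (hasDerivAt_Pt hfd hf t y).deriv]
  set s := Real.log (1 - Real.exp (-t))
  have h1 := hf'.dist_le_mul (x - t) (y - t)
  have h2 := lipschitzWith_gumbelCDF.dist_le_mul (x - t - s) (y - t - s)
  simp only [NNReal.coe_one, one_mul, Real.dist_eq, sub_sub_sub_cancel_right] at h1 h2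
  rw [Real.dist_eq, Real.dist_eq, NNReal.coe_ofNat]
  calc |deriv f (x - t) * gumbelCDF (x - t - s) - deriv f (y - t) * gumbelCDF (y - t - s)|
      = |(deriv f (x - t) - deriv f (y - t)) * gumbelCDF (x - t - s)
        + deriv f (y - t) * (gumbelCDF (x - t - s) - gumbelCDF (y - t - s))| := by ring_nf
    _ ≤ |deriv f (x - t) - deriv f (y - t)| * gumbelCDF (x - t - s)
        + |deriv f (y - t)| * |gumbelCDF (x - t - s) - gumbelCDF (y - t - s)| := by
      refine (abs_add_le _ _).trans_eq ?_
      rw [abs_mul, abs_mul, abs_of_nonneg (gumbelCDF_nonneg _)]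
    _ ≤ |x - y| * 1 + 1 * |x - y| := by
      gcongr
      · exact gumbelCDF_nonneg _
      · exact gumbelCDF_le_one _
      · exact abs_deriv_le_one hf _
    _ = 2 * |x - y| := by ring

lemma gumbelCDF_sub_log {t : ℝ} (ht : 0 < t) (x : ℝ) :
    gumbelCDF (x - t - Real.log (1 - Real.exp (-t)))
      = Real.exp (-((Real.exp t - 1) * Real.exp (-x))) := by
  have h : 0 < 1 - Real.exp (-t) := by simpa using ht
  have h1 : Real.exp t * Real.exp (-t) = 1 := by rw [← Real.exp_add]; simp
  rw [gumbelCDF, show -(x - t - Real.log (1 - Real.exp (-t)))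
    = t + Real.log (1 - Real.exp (-t)) + -x by ring, Real.exp_add, Real.exp_add,
    Real.exp_log h, mul_sub, h1, mul_one]

/-- For `b > 0`, `e^{-y} exp (-b e^{-y})` is integrable on `(0, ∞)` with integral
`(1 - e^{-b}) / b ≤ 1 / b`. -/
lemma integral_exp_neg_mul_exp_neg_mul_exp_neg_le {b : ℝ} (hb : 0 < b) :
    IntegrableOn (fun y => Real.exp (-y) * Real.exp (-(b * Real.exp (-y)))) (Set.Ioi 0) ∧
      ∫ y in Set.Ioi (0 : ℝ), Real.exp (-y) * Real.exp (-(b * Real.exp (-y))) ≤ 1 / b := by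
  have hd (y : ℝ) : HasDerivAt (fun y => Real.exp (-(b * Real.exp (-y))) / b)
      (Real.exp (-y) * Real.exp (-(b * Real.exp (-y)))) y := by
    have h := ((((hasDerivAt_neg y).exp.const_mul b).neg).exp).div_const b
    refine h.congr_deriv ?_
    simp only [Pi.neg_apply]
    field_simp
  have hnn (y : ℝ) (_ : y ∈ Set.Ioi (0 : ℝ)) :
      0 ≤ Real.exp (-y) * Real.exp (-(b * Real.exp (-y))) := by positivity
  have hlim : Filter.Tendsto (fun y => Real.exp (-(b * Real.exp (-y))) / b) Filter.atTop
      (nhds (1 / b)) := by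
    have h := ((Real.continuous_exp.tendsto _).comp
      ((Real.tendsto_exp_neg_atTop_nhds_zero.const_mul b).neg)).div_const b
    simpa [Function.comp_def] using h
  refine ⟨integrableOn_Ioi_deriv_of_nonneg' (fun y _ => hd y) hnn hlim, ?_⟩
  rw [integral_Ioi_of_hasDerivAt_of_nonneg' (fun y _ => hd y) hnn hlim]
  exact sub_le_self _ (by positivity)

lemma abs_L0_Pt_le {f : ℝ → ℝ} (hfd : Differentiable ℝ f) (hf : LipschitzWith 1 f)
    {t M : ℝ} (ht : 0 < t) (hM : ∀ z, |deriv f z| ≤ M) (x : ℝ) :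
    |L0 (Pt t f) x| ≤ 2 / (1 - Real.exp (-t)) * M := by
  have hM0 : 0 ≤ M := (abs_nonneg _).trans (hM 0)
  set c := Real.exp t - 1 with hc
  have hc0 : 0 < c := by simpa [hc] using ht
  have hderiv (y : ℝ) :
      |deriv (Pt t f) y| ≤ M * Real.exp (-(c * Real.exp (-y))) := by
    rw [(hasDerivAt_Pt hfd hf t y).deriv, gumbelCDF_sub_log ht, abs_mul, Real.abs_exp]
    gcongr
    exact hM _
  obtain ⟨hint, hle⟩ :=
    integral_exp_neg_mul_exp_neg_mul_exp_neg_le (mul_pos hc0 (Real.exp_pos (-x)))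
  have hI : |(∫ y in Set.Ioi (0 : ℝ), Real.exp (-y) * deriv (Pt t f) (x + y))|
      ≤ M * (1 / (c * Real.exp (-x))) := by
    rw [← Real.norm_eq_abs]
    refine (norm_integral_le_of_norm_le (G := ℝ) (hint.const_mul M)
      (.of_forall fun y => ?_)).trans ?_
    · rw [norm_mul, Real.norm_eq_abs, Real.norm_eq_abs, Real.abs_exp, mul_left_comm]
      refine mul_le_mul_of_nonneg_left ((hderiv (x + y)).trans_eq ?_) (Real.exp_pos _).le
      rw [neg_add, Real.exp_add, mul_assoc]
    · rw [integral_const_mul]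
      exact mul_le_mul_of_nonneg_left hle hM0
  have hexp : 2 / (1 - Real.exp (-t)) = 2 + 2 / c := by
    rw [Real.exp_neg, hc]
    have : Real.exp t - 1 ≠ 0 := hc0.ne'
    have := Real.exp_ne_zero t
    field_simp
    ring
  have h1 : |deriv (Pt t f) x| ≤ M := (hderiv x).trans
    (mul_le_of_le_one_right hM0 (Real.exp_le_one_iff.2 (neg_nonpos.2 (by positivity))))
  calc
    |L0 (Pt t f) x| ≤ |deriv (Pt t f) x|
        + Real.exp (-x) * |(∫ y in Set.Ioi (0 : ℝ),
          Real.exp (-y) * deriv (Pt t f) (x + y))| := by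
      refine (abs_add_le _ _).trans_eq ?_
      rw [abs_neg, abs_mul, Real.abs_exp]
    _ ≤ M + Real.exp (-x) * (M * (1 / (c * Real.exp (-x)))) := by gcongr
    _ = (1 + 1 / c) * M := by
      field_simp
    _ ≤ 2 / (1 - Real.exp (-t)) * M := by
      rw [hexp]
      gcongr <;> norm_num

/-- If `‖f‖_{Lip_{[2]}} ≤ 1`, i.e. `f` and `f'` are `1`-Lipschitz, then `P_t f ∈ Lip_{[2]}(ℝ)`:
`P_t f` is `1`-Lipschitz with `2`-Lipschitz derivative; moreover for `t > 0`,
`|𝓛₀ (P_t f) x| ≤ (2 / (1 - e^{-t})) · sup_z |f' z|`. -/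
theorem Pt_stable_Lip2 (f : ℝ → ℝ) (hfd : Differentiable ℝ f)
    (hf1 : LipschitzWith 1 f) (hf2 : LipschitzWith 1 (deriv f))
    (t : ℝ) (ht : 0 ≤ t) :
    LipschitzWith 1 (Pt t f) ∧ Differentiable ℝ (Pt t f) ∧
      LipschitzWith 2 (deriv (Pt t f)) ∧
      (0 < t → ∀ x : ℝ,
        |L0 (Pt t f) x| ≤ 2 / (1 - Real.exp (-t)) * ⨆ z : ℝ, |deriv f z|) := by
  refine ⟨lipschitzWith_Pt hfd hf1 t, fun x => (hasDerivAt_Pt hfd hf1 t x).differentiableAt,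
    lipschitzWith_deriv_Pt hfd hf1 hf2 t, fun ht0 x => abs_L0_Pt_le hfd hf1 ht0 (fun z => ?_) x⟩
  exact le_ciSup (f := fun z => |deriv f z|)
    ⟨1, Set.forall_mem_range.2 (abs_deriv_le_one hf1)⟩ z
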